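/- Assume the AG₂ setup and the definition of the rational functions a_τ (for τ/2 ∈ AG₂) below. Let s_γ(z) = z − (2⟨γ,z⟩/γ²)γ for γ ∈ ℂ² with γ² ≠ 0, and let W be the subgroup of linear automorphisms of ℂ² generated by {s_γ : γ ∈ G₂} (the Weyl group of type G₂). Then for every w ∈ W, every τ with τ/2 ∈ AG₂, and every z ∈ ℂ² such that both z and w⁻¹z are D₂-regular, one has a_{wτ}(z) = a_τ(w⁻¹z). -/

import Mathlib

noncomputable section

open Complex

/-- The bilinear extension of the Euclidean inner product on `ℂ²`. -/
def bil (z w : Fin 2 → ℂ) : ℂ := z 0 * w 0 + z 1 * w 1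

/-- `√3` as a complex number. -/
def rt3 : ℂ := (Real.sqrt 3 : ℝ)

def vα₁ : Fin 2 → ℂ := ![0, rt3]
def vα₂ : Fin 2 → ℂ := ![-(3/2), rt3 / 2]
def vα₃ : Fin 2 → ℂ := ![3/2, rt3 / 2]
def vβ₁ : Fin 2 → ℂ := ![1, 0]
def vβ₂ : Fin 2 → ℂ := ![1/2, rt3 / 2]
def vβ₃ : Fin 2 → ℂ := ![-(1/2), rt3 / 2]

/-- Positive roots of `G₂`: `α₁, α₂, α₃, β₁, β₂, β₃`. -/
def G2plus : List (Fin 2 → ℂ) := [vα₁, vα₂, vα₃, vβ₁, vβ₂, vβ₃]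
/-- The six short roots `±βᵢ` of `G₂`. -/
def shortRoots : List (Fin 2 → ℂ) := [vβ₁, vβ₂, vβ₃, -vβ₁, -vβ₂, -vβ₃]
/-- The six long roots `±αᵢ` of `G₂`. -/
def longRoots : List (Fin 2 → ℂ) := [vα₁, vα₂, vα₃, -vα₁, -vα₂, -vα₃]
/-- All twelve roots of `G₂`. -/
def G2all : List (Fin 2 → ℂ) := longRoots ++ shortRoots
/-- The twelve vectors `2γ`, `γ ∈ G₂`. -/
def twoG2 : List (Fin 2 → ℂ) := G2all.map (fun γ => (2 : ℂ) • γ)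
/-- The six vectors `±2βⱼ`. -/
def twoShort : List (Fin 2 → ℂ) := shortRoots.map (fun γ => (2 : ℂ) • γ)
/-- The six vectors `±2αⱼ`. -/
def twoLong : List (Fin 2 → ℂ) := longRoots.map (fun γ => (2 : ℂ) • γ)
/-- The six vectors `±4βⱼ`. -/
def fourShort : List (Fin 2 → ℂ) := shortRoots.map (fun γ => (4 : ℂ) • γ)
/-- The eighteen vectors `2γ`, `γ ∈ AG₂`. -/
def twoAG2 : List (Fin 2 → ℂ) := twoG2 ++ fourShort

/-- The quasi-invariance conditions for the configuration `AG₂` with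
multiplicities `m_{αᵢ} = m`, `m_{βᵢ} = 3m`, `m_{2βᵢ} = 1`. -/
def QuasiInvAG2 (m : ℕ) (ψ : (Fin 2 → ℂ) → ℂ) : Prop :=
  (∀ α ∈ [vα₁, vα₂, vα₃], ∀ s : ℕ, 1 ≤ s → s ≤ m →
    ∀ z : Fin 2 → ℂ, bil α z = 0 →
      ψ (z + (s : ℂ) • α) = ψ (z - (s : ℂ) • α)) ∧
  (∀ β ∈ [vβ₁, vβ₂, vβ₃], ∀ s : ℕ, ((1 ≤ s ∧ s ≤ 3 * m) ∨ s = 3 * m + 2) →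
    ∀ z : Fin 2 → ℂ, bil β z = 0 →
      ψ (z + (s : ℂ) • β) = ψ (z - (s : ℂ) • β))

/-- The linear form `z ↦ ⟨γ, z⟩` as a polynomial in `z₁, z₂`. -/
def linForm (γ : Fin 2 → ℂ) : MvPolynomial (Fin 2) ℂ :=
  MvPolynomial.C (γ 0) * MvPolynomial.X 0 + MvPolynomial.C (γ 1) * MvPolynomial.X 1

/-- The highest-order term `∏ᵢ ⟨αᵢ,z⟩^m ⟨βᵢ,z⟩^{3m} ⟨2βᵢ,z⟩` of the polynomial
part of the Baker–Akhiezer function for `AG₂`. -/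
def topTerm (m : ℕ) : MvPolynomial (Fin 2) ℂ :=
  (linForm vα₁ * linForm vα₂ * linForm vα₃) ^ m *
    (linForm vβ₁ * linForm vβ₂ * linForm vβ₃) ^ (3 * m) *
    (linForm ((2 : ℂ) • vβ₁) * linForm ((2 : ℂ) • vβ₂) * linForm ((2 : ℂ) • vβ₃))

/-- A Baker–Akhiezer function for `AG₂` at `x`. -/
def IsBAFunction (m : ℕ) (x : Fin 2 → ℂ) (ψ : (Fin 2 → ℂ) → ℂ) : Prop :=
  ∃ P : MvPolynomial (Fin 2) ℂ,
    P.totalDegree = 12 * m + 3 ∧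
    MvPolynomial.homogeneousComponent (12 * m + 3) P = topTerm m ∧
    (∀ z, ψ z = MvPolynomial.eval z P * Complex.exp (bil z x)) ∧
    QuasiInvAG2 m ψ

/-- `z` is `D₂`-regular: `⟨γ,z⟩ ∉ {0, ±γ², ±2γ², ±3γ²}` for every `γ ∈ G₂₊`. -/
def D2Reg (z : Fin 2 → ℂ) : Prop :=
  ∀ γ ∈ G2plus, bil γ z ≠ 0 ∧ bil γ z ≠ bil γ γ ∧ bil γ z ≠ -bil γ γ ∧
    bil γ z ≠ 2 * bil γ γ ∧ bil γ z ≠ -(2 * bil γ γ) ∧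
    bil γ z ≠ 3 * bil γ γ ∧ bil γ z ≠ -(3 * bil γ γ)

open scoped Classical in
/-- The coefficient functions `a_τ` (for `τ/2 ∈ AG₂`) of the dual
Macdonald–Ruijsenaars operator `D₂` for `AG₂`. -/
noncomputable def aD2 (m : ℕ) (τ z : Fin 2 → ℂ) : ℂ :=
  if τ ∈ fourShort then
    let h : Fin 2 → ℂ := (4⁻¹ : ℂ) • τ
    8 * bil h h *
      ((longRoots.filter (fun γ => bil τ γ = 2 * bil γ γ)).map (fun γ =>
        (1 - (m : ℂ) * bil γ γ / bil γ z) *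
        (1 - (m : ℂ) * bil γ γ / (bil γ z + bil γ γ)))).prod *
      ((shortRoots.filter (fun γ => bil τ γ = 2 * bil γ γ)).map (fun γ =>
        (1 - (3 * (m : ℂ) + 2) * bil γ γ / bil γ z) *
        (1 - 3 * (m : ℂ) * bil γ γ / (bil γ z + bil γ γ)))).prod *
      ((1 - (3 * (m : ℂ) + 2) * bil h h / bil h z) *
        (1 - 3 * (m : ℂ) * bil h h / (bil h z + bil h h)) *
        (1 - (3 * (m : ℂ) + 2) * bil h h / (bil h z + 2 * bil h h)) *
        (1 - 3 * (m : ℂ) * bil h h / (bil h z + 3 * bil h h)))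
  else if τ ∈ twoShort then
    let h : Fin 2 → ℂ := (2⁻¹ : ℂ) • τ
    9 * (m : ℂ) * ((m : ℂ) + 1) * bil h h *
      ((longRoots.filter (fun γ => bil τ γ = 0)).map (fun γ =>
        1 - (2 / 3 : ℂ) * bil γ γ / (bil γ z - bil γ γ))).prod *
      ((longRoots.filter (fun γ => bil τ γ = bil γ γ)).map (fun γ =>
        1 - (m : ℂ) * bil γ γ / bil γ z)).prod *
      ((shortRoots.filter (fun γ => bil τ γ = bil γ γ)).map (fun γ =>
        (1 - (3 * (m : ℂ) + 2) * bil γ γ / bil γ z) *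
        (1 + 3 * (m : ℂ) * bil γ γ / (bil γ z + 2 * bil γ γ)) *
        (1 - (3 * (m : ℂ) - 1) * bil γ γ / (bil γ z - bil γ γ)))).prod *
      ((1 - (3 * (m : ℂ) + 2) * bil h h / bil h z) *
        (1 - 3 * (m : ℂ) * bil h h / (bil h z + bil h h)) *
        (1 + 4 * bil h h / (bil h z + 3 * bil h h)) *
        (1 - 4 * bil h h / (bil h z - bil h h)))
  else
    let h : Fin 2 → ℂ := (2⁻¹ : ℂ) • τ
    (m : ℂ) * ((m : ℂ) + 1) * bil h h *
      ((shortRoots.filter (fun γ => bil τ γ = 3 * bil γ γ)).map (fun γ =>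
        (1 - (3 * (m : ℂ) + 2) * bil γ γ / bil γ z) *
        (1 - (3 * (m : ℂ) + 1) * bil γ γ / (bil γ z + bil γ γ)) *
        (1 - 3 * (m : ℂ) * bil γ γ / (bil γ z + 2 * bil γ γ)))).prod *
      ((shortRoots.filter (fun γ => bil τ γ = 0)).map (fun γ =>
        1 - 6 * bil γ γ / (bil γ z - bil γ γ))).prod *
      ((longRoots.filter (fun γ => bil τ γ = bil γ γ)).map (fun γ =>
        1 - (m : ℂ) * bil γ γ / bil γ z)).prod *
      ((1 - (m : ℂ) * bil h h / bil h z) *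
        (1 - (m : ℂ) * bil h h / (bil h z + bil h h)))

/-- The linear map `z ↦ ⟨γ,z⟩`. -/
noncomputable def bilinMap (γ : Fin 2 → ℂ) : (Fin 2 → ℂ) →ₗ[ℂ] ℂ where
  toFun z := bil γ z
  map_add' u v := by simp [bil]; ring
  map_smul' c u := by simp [bil]; ring

/-- The orthogonal reflection `s_γ(z) = z − (2⟨γ,z⟩/γ²)γ` as a linear
automorphism of `ℂ²`. -/
noncomputable def reflAt (γ : Fin 2 → ℂ) (h : bil γ γ ≠ 0) :
    (Fin 2 → ℂ) ≃ₗ[ℂ] (Fin 2 → ℂ) :=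
  Module.reflection (f := (2 / bil γ γ) • bilinMap γ) (x := γ)
    (by simp [bilinMap]; field_simp)

/-- The Weyl group of type `G₂`: the subgroup of linear automorphisms of `ℂ²`
generated by the reflections `s_γ`, `γ ∈ G₂`. -/
noncomputable def WeylG2 : Subgroup ((Fin 2 → ℂ) ≃ₗ[ℂ] (Fin 2 → ℂ)) :=
  Subgroup.closure {w | ∃ γ ∈ G2all, ∃ h : bil γ γ ≠ 0, w = reflAt γ h}


/-- Integer coordinates for the root lattice. -/
def zv (p : ℤ × ℤ) : Fin 2 → ℂ := ![(p.1 : ℂ) / 2, (p.2 : ℂ) * rt3 / 2]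

def zLong : List (ℤ × ℤ) := [(0, 2), (-3, 1), (3, 1), (0, -2), (3, -1), (-3, -1)]
def zShort : List (ℤ × ℤ) := [(2, 0), (1, 1), (-1, 1), (-2, 0), (-1, -1), (1, -1)]

def zbil (p q : ℤ × ℤ) : ℤ := p.1 * q.1 + 3 * (p.2 * q.2)

def zk (g x : ℤ × ℤ) : ℤ := 2 * zbil g x / zbil g g

def zrefl (g x : ℤ × ℤ) : ℤ × ℤ := (x.1 - zk g x * g.1, x.2 - zk g x * g.2)

theorem rt3_sq : rt3 * rt3 = 3 := by
  unfold rt3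
  rw [← Complex.ofReal_mul, Real.mul_self_sqrt (by norm_num)]
  norm_num

theorem rt3_ne : rt3 ≠ 0 := by
  intro h
  have := rt3_sq
  rw [h] at this
  norm_num at this

theorem zv_inj : Function.Injective zv := by
  intro p q h
  have h0 := congrFun h 0
  have h1 := congrFun h 1
  simp [zv, rt3_ne] at h0 h1
  exact Prod.ext h0 h1

theorem longRoots_eq : longRoots = zLong.map zv := by
  simp only [longRoots, zLong, List.map, vα₁, vα₂, vα₃, zv]
  simp only [List.cons.injEq, and_true]
  refine ⟨?_, ?_, ?_, ?_, ?_, ?_⟩ <;>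
  · ext i
    fin_cases i <;> simp <;> ring

theorem shortRoots_eq : shortRoots = zShort.map zv := by
  simp only [shortRoots, zShort, List.map, vβ₁, vβ₂, vβ₃, zv]
  simp only [List.cons.injEq, and_true]
  refine ⟨?_, ?_, ?_, ?_, ?_, ?_⟩ <;>
  · ext i
    fin_cases i <;> simp <;> ring

theorem bil_zv (p q : ℤ × ℤ) : bil (zv p) (zv q) = (zbil p q : ℂ) / 4 := by
  simp [bil, zv, zbil]
  linear_combination (p.2 * q.2 / 4 : ℂ) * rt3_sq

theorem reflAt_apply (γ : Fin 2 → ℂ) (h : bil γ γ ≠ 0) (x : Fin 2 → ℂ) :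
    reflAt γ h x = x - (2 / bil γ γ * bil γ x) • γ := by
  simp [reflAt, Module.reflection_apply, bilinMap]

theorem reflAt_zv (g x : ℤ × ℤ) (h : bil (zv g) (zv g) ≠ 0)
    (hd : zk g x * zbil g g = 2 * zbil g x) :
    reflAt (zv g) h (zv x) = zv (zrefl g x) := by
  have hk : 2 / bil (zv g) (zv g) * bil (zv g) (zv x) = (zk g x : ℂ) := by
    rw [div_mul_eq_mul_div, div_eq_iff h, bil_zv, bil_zv]
    have := congrArg (fun n : ℤ => (n : ℂ)) hd
    push_cast at this
    linear_combination -this / 4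
  rw [reflAt_apply, hk]
  ext i
  fin_cases i <;> simp [zv, zrefl] <;> ring

/-- The invariance properties of Weyl group elements that are needed. -/
structure Good (w : (Fin 2 → ℂ) ≃ₗ[ℂ] (Fin 2 → ℂ)) : Prop where
  iso : ∀ x y, bil (w x) (w y) = bil x y
  long : (longRoots.map w).Perm longRoots
  short : (shortRoots.map w).Perm shortRoots

theorem perm_of_maps (w : (Fin 2 → ℂ) ≃ₗ[ℂ] (Fin 2 → ℂ)) (L : List (ℤ × ℤ)) (hL : L.Nodup)
    (f : ℤ × ℤ → ℤ × ℤ) (h : ∀ x ∈ L, w (zv x) = zv (f x) ∧ f x ∈ L) :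
    ((L.map zv).map w).Perm (L.map zv) := by
  have hn : ((L.map zv).map w).Nodup := (hL.map zv_inj).map w.injective
  refine (hn.subperm ?_).perm_of_length_le (by simp)
  intro y hy
  simp only [List.mem_map] at hy ⊢
  obtain ⟨_, ⟨x, hx, rfl⟩, rfl⟩ := hy
  exact ⟨f x, (h x hx).2, (h x hx).1.symm⟩

theorem good_refl (γ : Fin 2 → ℂ) (hγ : γ ∈ G2all) (h : bil γ γ ≠ 0) : Good (reflAt γ h) := by
  have hz : ∃ g ∈ zLong ++ zShort, zv g = γ := by
    rw [G2all, longRoots_eq, shortRoots_eq, ← List.map_append] at hγ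
    exact List.mem_map.1 hγ
  obtain ⟨g, hg, rfl⟩ := hz
  have hl : ∀ g ∈ zLong ++ zShort, ∀ x ∈ zLong,
      zk g x * zbil g g = 2 * zbil g x ∧ zrefl g x ∈ zLong := by decide
  have hs : ∀ g ∈ zLong ++ zShort, ∀ x ∈ zShort,
      zk g x * zbil g g = 2 * zbil g x ∧ zrefl g x ∈ zShort := by decide
  refine ⟨fun x y => ?_, ?_, ?_⟩
  · rw [reflAt_apply, reflAt_apply]
    generalize zv g = γ at h
    have e : ∀ a b : ℂ, bil (x - a • γ) (y - b • γ)
        = bil x y - a * bil γ y - b * bil γ x + a * b * bil γ γ := by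
      intro a b; simp [bil]; ring
    rw [e]
    field_simp
    ring
  · rw [longRoots_eq]
    exact perm_of_maps _ _ (by decide) (zrefl g) fun x hx =>
      ⟨reflAt_zv g x h (hl g hg x hx).1, (hl g hg x hx).2⟩
  · rw [shortRoots_eq]
    exact perm_of_maps _ _ (by decide) (zrefl g) fun x hx =>
      ⟨reflAt_zv g x h (hs g hg x hx).1, (hs g hg x hx).2⟩

theorem perm_inv (w : (Fin 2 → ℂ) ≃ₗ[ℂ] (Fin 2 → ℂ)) (L : List (Fin 2 → ℂ))
    (h : (L.map w).Perm L) : (L.map (w⁻¹ : (Fin 2 → ℂ) ≃ₗ[ℂ] (Fin 2 → ℂ))).Perm L := by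
  have h2 := (h.map (w⁻¹ : (Fin 2 → ℂ) ≃ₗ[ℂ] (Fin 2 → ℂ))).symm
  rw [List.map_map] at h2
  have : ((w⁻¹ : (Fin 2 → ℂ) ≃ₗ[ℂ] (Fin 2 → ℂ)) : (Fin 2 → ℂ) → (Fin 2 → ℂ)) ∘ w = id := by
    funext x
    exact w.symm_apply_apply x
  rwa [this, List.map_id] at h2

theorem perm_mul (w v : (Fin 2 → ℂ) ≃ₗ[ℂ] (Fin 2 → ℂ)) (L : List (Fin 2 → ℂ))
    (hw : (L.map w).Perm L) (hv : (L.map v).Perm L) :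
    (L.map (w * v : (Fin 2 → ℂ) ≃ₗ[ℂ] (Fin 2 → ℂ))).Perm L := by
  have h2 := (hv.map w).trans hw
  rw [List.map_map] at h2
  exact h2

theorem good_weyl (w : (Fin 2 → ℂ) ≃ₗ[ℂ] (Fin 2 → ℂ)) (hw : w ∈ WeylG2) : Good w := by
  unfold WeylG2 at hw
  induction hw using Subgroup.closure_induction with
  | mem x hx =>
    obtain ⟨γ, hγ, h, rfl⟩ := hx
    exact good_refl γ hγ h
  | one => exact ⟨fun _ _ => rfl, by exact (List.map_id _) ▸ List.Perm.refl _,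
      by exact (List.map_id _) ▸ List.Perm.refl _⟩
  | mul x y _ _ hx hy =>
    exact ⟨fun a b => (hx.iso _ _).trans (hy.iso _ _), perm_mul _ _ _ hx.long hy.long,
      perm_mul _ _ _ hx.short hy.short⟩
  | inv x _ hx =>
    refine ⟨fun a b => ?_, perm_inv _ _ hx.long, perm_inv _ _ hx.short⟩
    rw [← hx.iso]
    exact congrArg₂ bil (x.apply_symm_apply a) (x.apply_symm_apply b)

theorem prod_equiv (w : (Fin 2 → ℂ) ≃ₗ[ℂ] (Fin 2 → ℂ)) (L : List (Fin 2 → ℂ))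
    (h : (L.map w).Perm L) (p q : (Fin 2 → ℂ) → Bool) (f g : (Fin 2 → ℂ) → ℂ)
    (hp : ∀ x, p (w x) = q x) (hf : ∀ x, f (w x) = g x) :
    ((L.filter p).map f).prod = ((L.filter q).map g).prod := by
  rw [← ((h.filter p).map f).prod_eq, List.filter_map, List.map_map]
  have h1 : p ∘ w = q := funext hp
  have h2 : f ∘ w = g := funext hf
  rw [h1, h2]

theorem mem_equiv (w : (Fin 2 → ℂ) ≃ₗ[ℂ] (Fin 2 → ℂ)) (L : List (Fin 2 → ℂ))
    (h : (L.map w).Perm L) (c : ℂ) (τ : Fin 2 → ℂ) :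
    w τ ∈ L.map (fun γ => c • γ) ↔ τ ∈ L.map (fun γ => c • γ) := by
  rw [← (h.map (fun γ => c • γ)).mem_iff]
  simp only [List.mem_map, exists_exists_and_eq_and]
  refine exists_congr fun a => and_congr_right fun _ => ?_
  rw [← map_smul]
  exact w.injective.eq_iff

theorem aD2_equiv (m : ℕ) (w : (Fin 2 → ℂ) ≃ₗ[ℂ] (Fin 2 → ℂ)) (hw : Good w)
    (τ y : Fin 2 → ℂ) : aD2 m (w τ) (w y) = aD2 m τ y := by
  have h4 : w τ ∈ fourShort ↔ τ ∈ fourShort := mem_equiv w _ hw.short 4 τ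
  have h2 : w τ ∈ twoShort ↔ τ ∈ twoShort := mem_equiv w _ hw.short 2 τ
  unfold aD2
  simp only [h4, h2, ← map_smul, hw.iso]
  split_ifs
  · refine congrArg₂ HMul.hMul (congrArg₂ HMul.hMul (congrArg₂ HMul.hMul rfl ?_) ?_) rfl
    · exact prod_equiv w _ hw.long _ _ _ _ (fun x => by simp only [hw.iso])
        (fun x => by simp only [hw.iso])
    · exact prod_equiv w _ hw.short _ _ _ _ (fun x => by simp only [hw.iso])
        (fun x => by simp only [hw.iso])
  · refine congrArg₂ HMul.hMul (congrArg₂ HMul.hMul (congrArg₂ HMul.hMul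
      (congrArg₂ HMul.hMul rfl ?_) ?_) ?_) rfl
    · exact prod_equiv w _ hw.long _ _ _ _ (fun x => by simp only [hw.iso])
        (fun x => by simp only [hw.iso])
    · exact prod_equiv w _ hw.long _ _ _ _ (fun x => by simp only [hw.iso])
        (fun x => by simp only [hw.iso])
    · exact prod_equiv w _ hw.short _ _ _ _ (fun x => by simp only [hw.iso])
        (fun x => by simp only [hw.iso])
  · refine congrArg₂ HMul.hMul (congrArg₂ HMul.hMul (congrArg₂ HMul.hMul
      (congrArg₂ HMul.hMul rfl ?_) ?_) ?_) rfl
    · exact prod_equiv w _ hw.short _ _ _ _ (fun x => by simp only [hw.iso])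
        (fun x => by simp only [hw.iso])
    · exact prod_equiv w _ hw.short _ _ _ _ (fun x => by simp only [hw.iso])
        (fun x => by simp only [hw.iso])
    · exact prod_equiv w _ hw.long _ _ _ _ (fun x => by simp only [hw.iso])
        (fun x => by simp only [hw.iso])

/-- `G₂`-symmetry of the coefficients of the operator `D₂`:
`a_{wτ}(z) = a_τ(w⁻¹z)` for all `w` in the Weyl group of `G₂`. -/
theorem stmt_14 (m : ℕ) (hm : 1 ≤ m) :
    ∀ w ∈ WeylG2, ∀ τ ∈ twoAG2, ∀ z : Fin 2 → ℂ,
      D2Reg z → D2Reg (w⁻¹ z) →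
        aD2 m (w τ) z = aD2 m τ (w⁻¹ z) := by
  intro w hw τ _ z _ _
  have h := aD2_equiv m w (good_weyl w hw) τ (w⁻¹ z)
  have e : w (w⁻¹ z) = z := w.apply_symm_apply z
  rwa [e] at h

end
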